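/- arXiv:1906.07608 — 8 statements merged into one kernel-verified Lean document; each statement's English description precedes it below -/
import Mathlib

section
/- Let Y be a real-valued random variable on a probability space with E[Y²] < ∞, and let A₁, A₂ ⊆ ℝ be nonempty Borel sets. Then Var(Y) ≥ (1/4) · min(P(Y ∈ A₁), P(Y ∈ A₂)) · (inf_{x₁ ∈ A₁, x₂ ∈ A₂} |x₁ − x₂|)². -/
open MeasureTheory ProbabilityTheory

theorem aux_cheb {Ω : Type*} [MeasurableSpace Ω] (μ : Measure Ω) [IsProbabilityMeasure μ]
    (Y : Ω → ℝ) (hY2 : MemLp Y 2 μ) (A : Set ℝ) (d : ℝ) (hd : 0 < d)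
    (h : ∀ x ∈ A, d / 2 ≤ |x - ∫ ω, Y ω ∂μ|) :
    (1 / 4) * (μ (Y ⁻¹' A)).toReal * d ^ 2 ≤ variance Y μ := by
  have h1 := meas_ge_le_variance_div_sq hY2 (half_pos hd)
  have h2 : μ (Y ⁻¹' A) ≤ ENNReal.ofReal (variance Y μ / (d / 2) ^ 2) :=
    (measure_mono (fun ω hω => h (Y ω) hω)).trans h1
  have h3 : (μ (Y ⁻¹' A)).toReal ≤ variance Y μ / (d / 2) ^ 2 :=
    ENNReal.toReal_le_of_le_ofReal (div_nonneg (variance_nonneg _ _) (sq_nonneg _)) h2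
  rw [le_div_iff₀ (by positivity)] at h3
  linarith

/-- **Lemma 2.3 of [gibbsCLT] / Lemma 7.2.**
Let `Y` be a real-valued square-integrable random variable on a probability space and let
`A₁, A₂ ⊆ ℝ` be nonempty Borel sets. Then
`Var(Y) ≥ (1/4) · min(P(Y ∈ A₁), P(Y ∈ A₂)) · (inf_{x₁ ∈ A₁, x₂ ∈ A₂} |x₁ − x₂|)²`. -/
theorem variance_ge_quarter_min_prob_mul_sq_inf_dist
    {Ω : Type*} [MeasurableSpace Ω] (μ : Measure Ω) [IsProbabilityMeasure μ]
    (Y : Ω → ℝ) (hYmeas : Measurable Y) (hY2 : MemLp Y 2 μ)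
    (A₁ A₂ : Set ℝ) (hA₁ : MeasurableSet A₁) (hA₂ : MeasurableSet A₂)
    (hne₁ : A₁.Nonempty) (hne₂ : A₂.Nonempty) :
    variance Y μ ≥
      (1 / 4) * min (μ (Y ⁻¹' A₁)).toReal (μ (Y ⁻¹' A₂)).toReal *
        (sInf ((fun p : ℝ × ℝ => |p.1 - p.2|) '' (A₁ ×ˢ A₂))) ^ 2 := by
  set d := sInf ((fun p : ℝ × ℝ => |p.1 - p.2|) '' (A₁ ×ˢ A₂)) with hd
  have hle : ∀ x ∈ A₁, ∀ y ∈ A₂, d ≤ |x - y| := by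
    intro x hx y hy
    refine csInf_le ⟨0, ?_⟩ ⟨(x, y), ⟨hx, hy⟩, rfl⟩
    rintro _ ⟨p, _, rfl⟩
    exact abs_nonneg _
  have h0 : 0 ≤ d := by
    refine Real.sInf_nonneg ?_
    rintro _ ⟨p, _, rfl⟩
    exact abs_nonneg _
  rcases h0.eq_or_lt with h | hpos
  · rw [← h]
    simp [variance_nonneg Y μ]
  by_cases hA : ∀ x ∈ A₁, d / 2 ≤ |x - ∫ ω, Y ω ∂μ|
  · refine ge_iff_le.2 (le_trans ?_ (aux_cheb μ Y hY2 A₁ d hpos hA))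
    gcongr
    exact min_le_left _ _
  · push Not at hA
    obtain ⟨x, hx, hxd⟩ := hA
    refine ge_iff_le.2 (le_trans ?_ (aux_cheb μ Y hY2 A₂ d hpos ?_))
    · gcongr
      exact min_le_right _ _
    · intro y hy
      have h1 := hle x hx y hy
      have h2 := abs_sub_le x (∫ ω, Y ω ∂μ) y
      rw [abs_sub_comm (∫ ω, Y ω ∂μ) y] at h2
      linarith
end

section
/- Let r_f > 0, let I be a finite index set, and let B, D : I → ℝ satisfy 0 < B_i < D_i ≤ r_f for all i ∈ I. For b, d ∈ [0, r_f] define β_{b,d} = #{i ∈ I : B_i ≤ b and d ≤ D_i}. Then for every r ∈ [0, r_f], ∫₀^r β_{b,0} db + ∫₀^{r_f} β_{r,t} dt − r·β_{r,0} = Σ_{i ∈ I} (D_i − B_i)·1{B_i ≤ r}. -/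
open scoped Classical


lemma step_up (B r : ℝ) (hB : 0 < B) (hr : 0 ≤ r) :
    (∫ b in (0 : ℝ)..r, (if B ≤ b then (1 : ℝ) else 0)) = if B ≤ r then r - B else 0 := by
  have h : (fun b : ℝ => if B ≤ b then (1 : ℝ) else 0) = (Set.Ici B).indicator 1 := by
    ext b; simp [Set.indicator_apply]
  rw [h, intervalIntegral.integral_of_le hr, MeasureTheory.integral_indicator_one measurableSet_Ici,
    MeasureTheory.measureReal_restrict_apply measurableSet_Ici]
  have h2 : Set.Ici B ∩ Set.Ioc 0 r = Set.Icc B r := by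
    ext x; simp only [Set.mem_inter_iff, Set.mem_Ici, Set.mem_Ioc, Set.mem_Icc]
    constructor
    · rintro ⟨a, b, c⟩; exact ⟨a, c⟩
    · rintro ⟨a, c⟩; exact ⟨a, by linarith, c⟩
  rw [h2]
  split_ifs with h3
  · rw [Real.volume_real_Icc_of_le h3]
  · rw [Set.Icc_eq_empty h3]; simp

lemma step_down (D r : ℝ) (hD : 0 < D) (hr : D ≤ r) :
    (∫ b in (0 : ℝ)..r, (if b ≤ D then (1 : ℝ) else 0)) = D := by
  have h : (fun b : ℝ => if b ≤ D then (1 : ℝ) else 0) = (Set.Iic D).indicator 1 := by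
    ext b; simp [Set.indicator_apply]
  rw [h, intervalIntegral.integral_of_le (by linarith),
    MeasureTheory.integral_indicator_one measurableSet_Iic,
    MeasureTheory.measureReal_restrict_apply measurableSet_Iic]
  have h2 : Set.Iic D ∩ Set.Ioc 0 r = Set.Ioc 0 D := by
    ext x; simp only [Set.mem_inter_iff, Set.mem_Iic, Set.mem_Ioc]
    constructor
    · rintro ⟨a, b, c⟩; exact ⟨b, a⟩
    · rintro ⟨a, c⟩; exact ⟨c, a, by linarith⟩
  rw [h2, Real.volume_real_Ioc_of_le hD.le, sub_zero]

/-- **Identity (A.1) for the accumulated persistence function.**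
Given finitely many features with birth times `B i` and death times `D i` satisfying
`0 < B i < D i ≤ r_f`, and persistent Betti numbers
`β b d = #{i : B i ≤ b ∧ d ≤ D i}`, one has for every `r ∈ [0, r_f]`:
`∫₀^r β_{b,0} db + ∫₀^{r_f} β_{r,t} dt − r·β_{r,0} = Σ_i (D i − B i)·1{B i ≤ r}`. -/
theorem apf_eq_integrals_of_persistent_betti
    {ι : Type*} (I : Finset ι) (rf : ℝ) (hrf : 0 < rf)
    (B D : ι → ℝ)
    (hB : ∀ i ∈ I, 0 < B i) (hBD : ∀ i ∈ I, B i < D i) (hD : ∀ i ∈ I, D i ≤ rf)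
    (β : ℝ → ℝ → ℝ)
    (hβ : ∀ b d : ℝ, β b d = ((I.filter (fun i => B i ≤ b ∧ d ≤ D i)).card : ℝ))
    (r : ℝ) (hr : r ∈ Set.Icc (0 : ℝ) rf) :
    (∫ b in (0 : ℝ)..r, β b 0) + (∫ t in (0 : ℝ)..rf, β r t) - r * β r 0
      = ∑ i ∈ I, (D i - B i) * (if B i ≤ r then (1 : ℝ) else 0) := by
  obtain ⟨hr0, hr1⟩ := hr
  have e0 : ∀ b, β b 0 = ∑ i ∈ I, (if B i ≤ b then (1 : ℝ) else 0) := by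
    intro b
    rw [hβ, Finset.card_filter, Nat.cast_sum]
    refine Finset.sum_congr rfl fun i hi => ?_
    have : 0 ≤ D i := by linarith [hB i hi, hBD i hi]
    simp [this]
  have e1 : ∀ t, β r t =
      ∑ i ∈ I, (if B i ≤ r then (1 : ℝ) else 0) * (if t ≤ D i then (1 : ℝ) else 0) := by
    intro t
    rw [hβ, Finset.card_filter, Nat.cast_sum]
    refine Finset.sum_congr rfl fun i hi => ?_
    by_cases h1 : B i ≤ r <;> by_cases h2 : t ≤ D i <;> simp [h1, h2]
  have e2 : r * β r 0 = ∑ i ∈ I, r * (if B i ≤ r then (1 : ℝ) else 0) := by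
    rw [e0, Finset.mul_sum]
  have i0 : (∫ b in (0 : ℝ)..r, β b 0) = ∑ i ∈ I, if B i ≤ r then r - B i else 0 := by
    simp only [e0]
    rw [intervalIntegral.integral_finsetSum]
    · exact Finset.sum_congr rfl fun i hi => step_up _ _ (hB i hi) hr0
    · intro i hi
      apply Monotone.intervalIntegrable
      intro x y hxy
      dsimp only
      split_ifs <;> linarith
  have i1 : (∫ t in (0 : ℝ)..rf, β r t) =
      ∑ i ∈ I, (if B i ≤ r then (1 : ℝ) else 0) * D i := by
    simp only [e1]
    rw [intervalIntegral.integral_finsetSum]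
    · refine Finset.sum_congr rfl fun i hi => ?_
      rw [intervalIntegral.integral_const_mul,
        step_down _ _ (by linarith [hB i hi, hBD i hi]) (hD i hi)]
    · intro i hi
      apply IntervalIntegrable.const_mul
      apply Antitone.intervalIntegrable
      intro x y hxy
      dsimp only
      split_ifs <;> linarith
  rw [i0, i1, e2, ← Finset.sum_add_distrib, ← Finset.sum_sub_distrib]
  refine Finset.sum_congr rfl fun i hi => ?_
  split_ifs <;> ring
end

section
/- Let x, y ∈ ℝ² with x ≠ y, set a = |x − y|/2, and let 0 ≤ d₋ ≤ d₊ with a ≤ d₊. Then the Lebesgue area of D_{d₋,d₊}(x,y) equals 2·d₊²·(π − arcsin(a/d₊) + (a/d₊)·√(1 − (a/d₊)²)) − 2·(d₋∨a)²·(π − arcsin(a/(d₋∨a)) + (a/(d₋∨a))·√(1 − (a/(d₋∨a))²)). -/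
open MeasureTheory Real
open scoped Classical

noncomputable section

/-- The Euclidean plane. -/
abbrev E2 : Type := EuclideanSpace ℝ (Fin 2)

/-- Rotation of a planar vector by `π/2`; it is orthogonal to `v` and has the same norm. -/
def perp (v : E2) : E2 := (WithLp.equiv 2 (Fin 2 → ℝ)).symm ![-(v 1), v 0]

/-- For `d ≥ a := |x − y|/2`, the closed disk of radius `d` whose boundary circle passes
through `x` and `y`, with center `midpoint x y + sgn·√(d² − a²)·n`, where `n` is the unit
vector orthogonal to `y − x` obtained by normalizing `perp (y - x)`; for `d < a` it is
empty.  `sgn = 1` gives `B_d^+(x,y)` and `sgn = -1` gives `B_d^-(x,y)`. -/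
def diskPM (x y : E2) (d : ℝ) (sgn : ℝ) : Set E2 :=
  if d < ‖y - x‖ / 2 then ∅
  else Metric.closedBall
    (midpoint ℝ x y + ((sgn * Real.sqrt (d ^ 2 - (‖y - x‖ / 2) ^ 2)) / ‖y - x‖) • perp (y - x)) d

/-- The set `D_{d₋,d₊}(x,y)` of points `z` such that the boundaries of the three equal disks
around `x`, `y`, `z` meet at a time `r` with `d₋ < r ≤ d₊`; empty when `x = y`. -/
def Dset (x y : E2) (dm dp : ℝ) : Set E2 :=
  if x = y then ∅
  else
    (diskPM x y dp 1 ∪ diskPM x y dp (-1)) \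
      (diskPM x y (max dm (‖y - x‖ / 2)) 1 ∪ diskPM x y (max dm (‖y - x‖ / 2)) (-1))

end

def Vset (a h : ℝ) : Set (ℝ × ℝ) := {q | q.1 ^ 2 + q.2 ^ 2 ≤ a ^ 2 + 2 * h * |q.1|}

lemma Vset_meas (a h : ℝ) : MeasurableSet (Vset a h) := by
  apply IsClosed.measurableSet
  apply isClosed_le <;> fun_prop

lemma Vset_slice (a h u : ℝ) :
    volume (Prod.mk u ⁻¹' Vset a h) = ENNReal.ofReal (2 * √(a ^ 2 + 2 * h * |u| - |u| ^ 2)) := by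
  by_cases hc : 0 ≤ a ^ 2 + 2 * h * |u| - |u| ^ 2
  · have : Prod.mk u ⁻¹' Vset a h =
        Set.Icc (-√(a ^ 2 + 2 * h * |u| - |u| ^ 2)) (√(a ^ 2 + 2 * h * |u| - |u| ^ 2)) := by
      ext v
      rw [Set.mem_Icc, ← abs_le, Set.mem_preimage]
      rw [← Real.sqrt_sq_eq_abs, Real.sqrt_le_sqrt_iff hc, sq_abs]
      simp only [Vset, Set.mem_ofPred_eq]
      constructor <;> intro h <;> linarith
    rw [this, Real.volume_Icc]
    congr 1
    ring
  · have : Prod.mk u ⁻¹' Vset a h = ∅ := by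
      ext v
      simp only [Vset, Set.mem_preimage, Set.mem_ofPred_eq, Set.mem_empty_iff_false, iff_false]
      intro h
      rw [sq_abs] at hc
      nlinarith [sq_nonneg v]
    rw [this, Real.sqrt_eq_zero_of_nonpos (by linarith)]
    simp

lemma prim_deriv (a h d u : ℝ) (hd : 0 < d) (hh : d ^ 2 = a ^ 2 + h ^ 2)
    (h1 : -d < u - h) (h2 : u - h < d) :
    HasDerivAt (fun u => d ^ 2 * arcsin ((u - h) / d) + (u - h) * √(a ^ 2 + 2 * h * u - u ^ 2))
      (2 * √(a ^ 2 + 2 * h * u - u ^ 2)) u := by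
  have hpos : 0 < a ^ 2 + 2 * h * u - u ^ 2 := by nlinarith
  have e1 : HasDerivAt (fun u : ℝ => (u - h) / d) (1 / d) u :=
    ((hasDerivAt_id u).sub_const h).div_const d
  have n1 : (u - h) / d ≠ -1 := by
    intro hc; rw [div_eq_iff hd.ne'] at hc; linarith
  have n2 : (u - h) / d ≠ 1 := by
    intro hc; rw [div_eq_iff hd.ne'] at hc; linarith
  have e2 := (Real.hasDerivAt_arcsin n1 n2).comp u e1
  have e3 : HasDerivAt (fun u : ℝ => a ^ 2 + 2 * h * u - u ^ 2) (2 * h - 2 * u) u := by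
    have := (((hasDerivAt_id u).const_mul (2 * h)).const_add (a ^ 2)).sub ((hasDerivAt_id u).pow 2)
    exact this.congr_deriv (by simp)
  have e4 := e3.sqrt hpos.ne'
  have e5 := (e2.const_mul (d ^ 2)).add (((hasDerivAt_id u).sub_const h).mul e4)
  refine e5.congr_deriv ?_
  have hs : √(1 - ((u - h) / d) ^ 2) = √(a ^ 2 + 2 * h * u - u ^ 2) / d := by
    rw [← Real.sqrt_sq (show 0 ≤ √(a ^ 2 + 2 * h * u - u ^ 2) / d by positivity), div_pow, div_pow,
      Real.sq_sqrt hpos.le]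
    congr 1
    field_simp
    linarith
  rw [hs]
  have hS := Real.sq_sqrt hpos.le
  have hS0 : √(a ^ 2 + 2 * h * u - u ^ 2) ≠ 0 := (Real.sqrt_pos.2 hpos).ne'
  generalize √(a ^ 2 + 2 * h * u - u ^ 2) = S at *
  simp only [id]
  field_simp
  linarith

lemma Vset_vol (a h d : ℝ) (ha : 0 < a) (hd : 0 < d) (h0 : 0 ≤ h) (hh : d ^ 2 = a ^ 2 + h ^ 2) :
    volume (Vset a h) = ENNReal.ofReal (2 * (d ^ 2 * (π / 2) + d ^ 2 * arcsin (h / d) + h * a)) := by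
  have hlt : h < d := by nlinarith
  rw [Measure.volume_eq_prod, Measure.prod_apply (Vset_meas a h)]
  simp_rw [Vset_slice]
  set g : ℝ → ℝ := fun u => 2 * √(a ^ 2 + 2 * h * u - u ^ 2) with hg
  have hgc : Continuous g := by fun_prop
  have hz : ∀ u, h + d < u → g u = 0 := by
    intro u hu
    simp only [hg]
    rw [Real.sqrt_eq_zero_of_nonpos (by nlinarith)]
    simp
  have hint : Integrable (fun u => g |u|) := by
    apply Continuous.integrable_of_hasCompactSupport (by fun_prop)
    apply HasCompactSupport.intro (isCompact_Icc (a := -(h + d)) (b := h + d))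
    intro u hu
    apply hz
    by_contra hc
    exact hu (abs_le.1 (not_lt.1 hc))
  rw [← ofReal_integral_eq_lintegral_ofReal hint
    (Filter.Eventually.of_forall fun u => by simp only [hg]; positivity)]
  congr 1
  rw [integral_comp_abs (f := g)]
  congr 1
  have hsub : ∫ u in Set.Ioi (0:ℝ), g u = ∫ u in Set.Ioc (0:ℝ) (h + d), g u := by
    apply setIntegral_eq_of_subset_of_forall_sdiff_eq_zero measurableSet_Ioi Set.Ioc_subset_Ioi_self
    intro u hu
    apply hz
    by_contra hc
    exact hu.2 ⟨hu.1, not_lt.1 hc⟩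
  rw [hsub, ← intervalIntegral.integral_of_le (by positivity)]
  rw [intervalIntegral.integral_eq_sub_of_hasDerivAt_of_le (by positivity)
    (f := fun u => d ^ 2 * arcsin ((u - h) / d) + (u - h) * √(a ^ 2 + 2 * h * u - u ^ 2))
    (by apply Continuous.continuousOn
        have := Real.continuous_arcsin
        fun_prop)
    (fun u hu => prim_deriv a h d u hd hh (by linarith [hu.1]) (by linarith [hu.2]))
    (hgc.intervalIntegrable _ _)]
  have t1 : a ^ 2 + 2 * h * (h + d) - (h + d) ^ 2 = 0 := by linarith
  have t2 : a ^ 2 + 2 * h * 0 - 0 ^ 2 = a ^ 2 := by ring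
  have t3 : (h + d - h) / d = 1 := by field_simp; ring
  have t4 : (0 - h) / d = -(h / d) := by ring
  simp only [t1, t2, t3, t4, arcsin_one, arcsin_neg, Real.sqrt_zero, Real.sqrt_sq ha.le]
  ring

lemma Vset_area (a h d : ℝ) (ha : 0 < a) (hd : 0 < d) (h0 : 0 ≤ h) (hh : d ^ 2 = a ^ 2 + h ^ 2) :
    (volume (Vset a h)).toReal =
      2 * d ^ 2 * (π - Real.arcsin (a / d) + (a / d) * Real.sqrt (1 - (a / d) ^ 2)) := by
  have hs : √(1 - (a / d) ^ 2) = h / d := by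
    rw [← Real.sqrt_sq (show 0 ≤ h / d by positivity)]
    congr 1
    field_simp
    linarith
  have hc : arcsin (h / d) = π / 2 - arcsin (a / d) := by
    rw [← hs, ← Real.arccos_eq_arcsin (by positivity), Real.arccos]
  have hn : 0 ≤ arcsin (h / d) := Real.arcsin_nonneg.2 (by positivity)
  rw [Vset_vol a h d ha hd h0 hh, ENNReal.toReal_ofReal (by positivity), hs, hc]
  field_simp
  ring

/-- rotation -/
noncomputable def rotL (c s : ℝ) : E2 →ₗ[ℝ] E2 where
  toFun p := !₂[p 1 * c - p 0 * s, p 1 * s + p 0 * c]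
  map_add' p q := by ext i; fin_cases i <;> simp <;> ring
  map_smul' r p := by ext i; fin_cases i <;> simp <;> ring

lemma rotL_norm (c s : ℝ) (hcs : c ^ 2 + s ^ 2 = 1) (p : E2) : ‖rotL c s p‖ = ‖p‖ := by
  rw [EuclideanSpace.norm_eq, EuclideanSpace.norm_eq]
  congr 1
  simp [rotL, Fin.sum_univ_two]
  linear_combination (p 0 ^ 2 + p 1 ^ 2) * hcs

lemma exists_coord (m : E2) (c s : ℝ) (hcs : c ^ 2 + s ^ 2 = 1) :
    ∃ T : ℝ × ℝ → E2, MeasurePreserving T ∧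
      ∀ q (k d : ℝ), 0 ≤ d → (T q ∈ Metric.closedBall (m + k • !₂[-s, c]) d ↔
        (q.1 - k) ^ 2 + q.2 ^ 2 ≤ d ^ 2) := by
  let L : E2 ≃ₗᵢ[ℝ] E2 :=
    (LinearIsometry.mk (rotL c s) (rotL_norm c s hcs)).toLinearIsometryEquiv rfl
  have hL : ∀ p, L p = rotL c s p := fun p => rfl
  let T : ℝ × ℝ → E2 := fun q => m + L (!₂[q.1, q.2])
  refine ⟨T, ?_, ?_⟩
  · have h1 := (volume_preserving_finTwoArrow ℝ).symm
    have h2 := (EuclideanSpace.volume_preserving_symm_measurableEquiv_toLp (Fin 2)).symm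
    have h3 := (measurePreserving_add_left (volume : Measure E2) m).comp
      (L.measurePreserving.comp (h2.comp h1))
    exact h3
  · intro q k d hd
    have : T q - (m + k • !₂[-s, c]) = L (!₂[q.1 - k, q.2]) := by
      rw [hL]
      simp only [T, hL]
      ext i
      fin_cases i <;> simp [rotL] <;> ring
    rw [mem_closedBall_iff_norm, this, L.norm_map, EuclideanSpace.norm_eq,
      Real.sqrt_le_left hd]
    simp [Fin.sum_univ_two]

/-- **Lemma 7.5 (area formula).** For `x ≠ y` in the plane, `a = |x − y|/2`, and
`0 ≤ d₋ ≤ d₊` with `a ≤ d₊`, the Lebesgue area of `D_{d₋,d₊}(x,y)` equals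
`2d₊²(π − arcsin(a/d₊) + (a/d₊)√(1−(a/d₊)²))
 − 2(d₋∨a)²(π − arcsin(a/(d₋∨a)) + (a/(d₋∨a))√(1−(a/(d₋∨a))²))`. -/
theorem area_Dset_eq (x y : E2) (hxy : x ≠ y) (a : ℝ) (ha : a = ‖x - y‖ / 2)
    (dm dp : ℝ) (hdm : 0 ≤ dm) (hdmdp : dm ≤ dp) (hadp : a ≤ dp) :
    (volume (Dset x y dm dp)).toReal =
      2 * dp ^ 2 *
          (π - Real.arcsin (a / dp) + (a / dp) * Real.sqrt (1 - (a / dp) ^ 2))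
        - 2 * (max dm a) ^ 2 *
          (π - Real.arcsin (a / max dm a)
            + (a / max dm a) * Real.sqrt (1 - (a / max dm a) ^ 2)) := by
  have hn : 0 < ‖y - x‖ := norm_pos_iff.2 (sub_ne_zero.2 hxy.symm)
  have ha' : ‖y - x‖ / 2 = a := by rw [ha, norm_sub_rev]
  have hnn : ‖y - x‖ = 2 * a := by linarith
  have ha0 : 0 < a := by linarith
  have hcs : ((y - x) 0 / ‖y - x‖) ^ 2 + ((y - x) 1 / ‖y - x‖) ^ 2 = 1 := by
    have := EuclideanSpace.norm_sq_eq (y - x)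
    simp only [Fin.sum_univ_two, Real.norm_eq_abs, sq_abs] at this
    rw [div_pow, div_pow, ← add_div, ← this, div_self (by positivity)]
  obtain ⟨T, hT, hTm⟩ := exists_coord (midpoint ℝ x y) _ _ hcs
  have key : ∀ d, a ≤ d → T ⁻¹' (diskPM x y d 1 ∪ diskPM x y d (-1)) = Vset a (√(d ^ 2 - a ^ 2)) := by
    intro d hd
    have hsq : √(d ^ 2 - a ^ 2) ^ 2 = d ^ 2 - a ^ 2 := Real.sq_sqrt (by nlinarith)
    have hnn := Real.sqrt_nonneg (d ^ 2 - a ^ 2)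
    ext q
    have hv : ∀ σ : ℝ, T q ∈ diskPM x y d σ ↔
        (q.1 - σ * √(d ^ 2 - a ^ 2)) ^ 2 + q.2 ^ 2 ≤ d ^ 2 := by
      intro σ
      rw [← hTm q _ d (by linarith), diskPM, if_neg (by rw [ha']; linarith), ha']
      have : (σ * √(d ^ 2 - a ^ 2) / ‖y - x‖) • perp (y - x) =
          (σ * √(d ^ 2 - a ^ 2)) • !₂[-((y - x) 1 / ‖y - x‖), (y - x) 0 / ‖y - x‖] := by
        ext i
        fin_cases i <;> simp [perp] <;> ring
      rw [this]
    rw [Set.mem_preimage, Set.mem_union, hv, hv]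
    simp only [Vset, Set.mem_ofPred_eq]
    generalize √(d ^ 2 - a ^ 2) = h at *
    constructor
    · rintro (h1 | h1)
      · nlinarith [mul_le_mul_of_nonneg_left (le_abs_self q.1) hnn]
      · nlinarith [mul_le_mul_of_nonneg_left (neg_abs_le q.1) hnn]
    · intro h1
      rcases abs_cases q.1 with ⟨h2, _⟩ | ⟨h2, _⟩ <;> rw [h2] at h1
      · left; nlinarith
      · right; nlinarith
  have dmeas : ∀ d σ, MeasurableSet (diskPM x y d σ) := by
    intro d σ
    unfold diskPM
    split_ifs
    · exact MeasurableSet.empty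
    · exact measurableSet_closedBall
  have hm : a ≤ max dm a := le_max_right _ _
  have hmp : max dm a ≤ dp := max_le hdmdp hadp
  rw [Dset, if_neg hxy, ha', ← hT.measure_preimage
    ((((dmeas _ _).union (dmeas _ _)).diff ((dmeas _ _).union (dmeas _ _))).nullMeasurableSet),
    Set.preimage_sdiff, key _ hadp, key _ hm]
  have hsub : Vset a (√((max dm a) ^ 2 - a ^ 2)) ⊆ Vset a (√(dp ^ 2 - a ^ 2)) := by
    intro q hq
    simp only [Vset, Set.mem_ofPred_eq] at hq ⊢
    have : √((max dm a) ^ 2 - a ^ 2) ≤ √(dp ^ 2 - a ^ 2) := by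
      apply Real.sqrt_le_sqrt
      nlinarith
    nlinarith [mul_le_mul_of_nonneg_right this (abs_nonneg q.1)]
  have e : ∀ d, a ≤ d → d ^ 2 = a ^ 2 + √(d ^ 2 - a ^ 2) ^ 2 := by
    intro d hd
    rw [Real.sq_sqrt (by nlinarith)]
    ring
  have fin : ∀ d, a ≤ d → volume (Vset a (√(d ^ 2 - a ^ 2))) ≠ ⊤ := by
    intro d hd
    rw [Vset_vol a _ d ha0 (by linarith) (Real.sqrt_nonneg _) (e d hd)]
    exact ENNReal.ofReal_ne_top
  rw [measure_sdiff hsub (Vset_meas _ _).nullMeasurableSet (fin _ hm),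
    ENNReal.toReal_sub_of_le (measure_mono hsub) (fin _ hadp),
    Vset_area a _ dp ha0 (by linarith) (Real.sqrt_nonneg _) (e dp hadp),
    Vset_area a _ (max dm a) ha0 (by linarith) (Real.sqrt_nonneg _) (e _ hm)]
end

section
/- For every r_f > 0 there exists a constant C > 0 such that for all x, y ∈ ℝ² with x ≠ y and a = |x − y|/2, and all 0 ≤ d₋ ≤ d₊ ≤ r_f with a ≤ d₊, the Lebesgue area of D_{d₋,d₊}(x,y) is at most C · d₊ · √(d₊ − d₋). -/
open MeasureTheory Real
open scoped Classical

lemma aux_vol (c : E2) (r : ℝ) (hr : 0 ≤ r) :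
    volume.real (Metric.closedBall c r) = π * r ^ 2 := by
  rw [Measure.real, EuclideanSpace.volume_closedBall_fin_two]
  simp [ENNReal.toReal_ofReal hr, mul_comm, pi_nonneg]

lemma aux_ball (c1 c2 : E2) (d e : ℝ) (he : 0 ≤ e) (hed : e ≤ d) :
    volume.real (Metric.closedBall c1 d \ Metric.closedBall c2 e)
      ≤ 2 * π * d * (d - e + dist c1 c2) := by
  have hd : 0 ≤ d := he.trans hed
  have hpi := pi_pos
  have hD : 0 ≤ dist c1 c2 := dist_nonneg
  have hfin : volume (Metric.closedBall c1 d) ≠ ⊤ := measure_closedBall_lt_top.ne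
  by_cases h : e < dist c1 c2
  · calc _ ≤ volume.real (Metric.closedBall c1 d) := measureReal_mono Set.diff_subset hfin
      _ = π * d ^ 2 := aux_vol _ _ hd
      _ ≤ _ := by
        have : 0 ≤ π * d * (d + 2 * (dist c1 c2 - e)) := by
          have : 0 ≤ d + 2 * (dist c1 c2 - e) := by linarith
          positivity
        nlinarith
  · push Not at h
    have hsub : Metric.closedBall c1 (e - dist c1 c2) ⊆ Metric.closedBall c1 d :=
      Metric.closedBall_subset_closedBall (by linarith)
    have hsub2 : Metric.closedBall c1 (e - dist c1 c2) ⊆ Metric.closedBall c2 e :=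
      Metric.closedBall_subset_closedBall' (by linarith)
    calc _ ≤ volume.real (Metric.closedBall c1 d \ Metric.closedBall c1 (e - dist c1 c2)) :=
          measureReal_mono (Set.diff_subset_diff_right hsub2)
            (measure_ne_top_of_subset Set.diff_subset hfin)
      _ = π * d ^ 2 - π * (e - dist c1 c2) ^ 2 := by
        rw [measureReal_diff hsub Metric.isClosed_closedBall.measurableSet, aux_vol _ _ hd,
          aux_vol _ _ (by linarith)]
      _ ≤ _ := by
        have : 0 ≤ π * (d - e + dist c1 c2) * (d - e + dist c1 c2) := by
          have : 0 ≤ d - e + dist c1 c2 := by linarith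
          positivity
        nlinarith

lemma norm_perp' (v : E2) : ‖perp v‖ = ‖v‖ := by
  simp [perp, EuclideanSpace.norm_eq, Fin.sum_univ_two, add_comm]

lemma aux_disk (x y : E2) (hxy : x ≠ y) (d e sgn : ℝ) (hs : |sgn| = 1)
    (hae : ‖y - x‖ / 2 ≤ e) (hed : e ≤ d) :
    volume.real (diskPM x y d sgn \ diskPM x y e sgn)
      ≤ 2 * π * d * (d - e + √(2 * d) * √(d - e)) := by
  have hv : 0 < ‖y - x‖ := norm_pos_iff.2 (sub_ne_zero.2 hxy.symm)
  have he : 0 ≤ e := by linarith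
  unfold diskPM
  rw [if_neg (by linarith), if_neg (by linarith)]
  refine (aux_ball _ _ d e he hed).trans ?_
  have hd : 0 ≤ d := by linarith
  refine mul_le_mul_of_nonneg_left ?_ (by positivity)
  gcongr
  set a := ‖y - x‖ / 2 with ha
  rw [dist_add_left, dist_eq_norm, ← sub_smul, norm_smul, norm_perp', ← sub_div, ← mul_sub,
    Real.norm_eq_abs, abs_div, abs_mul, hs, abs_of_pos hv, one_mul, div_mul_cancel₀ _ hv.ne',
    ← Real.sqrt_mul (by positivity)]
  have h1 : √(e ^ 2 - a ^ 2) ≤ √(d ^ 2 - a ^ 2) := by gcongr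
  rw [abs_of_nonneg (by linarith)]
  apply Real.le_sqrt_of_sq_le
  have h2 : √(e ^ 2 - a ^ 2) ^ 2 = e ^ 2 - a ^ 2 := Real.sq_sqrt (by nlinarith)
  have h3 : √(d ^ 2 - a ^ 2) ^ 2 = d ^ 2 - a ^ 2 := Real.sq_sqrt (by nlinarith)
  nlinarith [Real.sqrt_nonneg (e ^ 2 - a ^ 2), mul_nonneg (sub_nonneg.2 hed) (sub_nonneg.2 hed),
    mul_nonneg (Real.sqrt_nonneg (e ^ 2 - a ^ 2)) (sub_nonneg.2 h1)]

/-- **Lemma 7.5 (area bound).** For every `r_f > 0` there is a constant `C > 0` such that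
for all `x ≠ y` with `a = |x − y|/2` and all `0 ≤ d₋ ≤ d₊ ≤ r_f` with `a ≤ d₊`,
the Lebesgue area of `D_{d₋,d₊}(x,y)` is at most `C·d₊·√(d₊ − d₋)`. -/
theorem area_Dset_le (rf : ℝ) (hrf : 0 < rf) :
    ∃ C > 0, ∀ (x y : E2), x ≠ y → ∀ (a : ℝ), a = ‖x - y‖ / 2 →
      ∀ (dm dp : ℝ), 0 ≤ dm → dm ≤ dp → dp ≤ rf → a ≤ dp →
      (volume (Dset x y dm dp)).toReal ≤ C * dp * Real.sqrt (dp - dm) := by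
  refine ⟨4 * π * (√rf + √(2 * rf)), by positivity, ?_⟩
  intro x y hxy a ha dm dp h0 hmp hpr hap
  rw [norm_sub_rev] at ha
  have hd : 0 ≤ dp := h0.trans hmp
  unfold Dset
  rw [if_neg hxy, ← ha]
  set e := max dm a with he
  have hae : a ≤ e := le_max_right _ _
  have hme : dm ≤ e := le_max_left _ _
  have hed : e ≤ dp := max_le hmp hap
  have hfin : ∀ s, volume (diskPM x y dp s) ≠ ⊤ := by
    intro s
    unfold diskPM
    split_ifs
    · simp
    · exact measure_closedBall_lt_top.ne
  have hb : ∀ s : ℝ, |s| = 1 → volume.real (diskPM x y dp s \ diskPM x y e s)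
      ≤ 2 * π * dp * ((√rf + √(2 * rf)) * √(dp - dm)) := by
    intro s hs
    refine (aux_disk x y hxy dp e s hs (ha ▸ hae) hed).trans ?_
    refine mul_le_mul_of_nonneg_left ?_ (by positivity)
    rw [add_mul]
    have h1 : √(dp - e) ≤ √(dp - dm) := by gcongr
    have h2 : dp - e = √(dp - e) * √(dp - e) := (Real.mul_self_sqrt (by linarith)).symm
    have h3 : √(dp - e) ≤ √rf := Real.sqrt_le_sqrt (by linarith)
    refine add_le_add ?_ ?_
    · rw [h2]; gcongr
    · gcongr
  have hsub : (diskPM x y dp 1 ∪ diskPM x y dp (-1)) \ (diskPM x y e 1 ∪ diskPM x y e (-1)) ⊆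
      (diskPM x y dp 1 \ diskPM x y e 1) ∪ (diskPM x y dp (-1) \ diskPM x y e (-1)) := by
    rintro z ⟨h | h, hn⟩
    · exact Or.inl ⟨h, fun h' => hn (Or.inl h')⟩
    · exact Or.inr ⟨h, fun h' => hn (Or.inr h')⟩
  change volume.real _ ≤ _
  calc _ ≤ volume.real ((diskPM x y dp 1 \ diskPM x y e 1) ∪
        (diskPM x y dp (-1) \ diskPM x y e (-1))) :=
        measureReal_mono hsub (measure_union_ne_top
          (measure_ne_top_of_subset Set.diff_subset (hfin _))
          (measure_ne_top_of_subset Set.diff_subset (hfin _)))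
    _ ≤ _ := measureReal_union_le _ _
    _ ≤ _ := add_le_add (hb 1 (by simp)) (hb (-1) (by simp))
    _ = _ := by ring
end

section
/- Let 0 < d and 0 ≤ a ≤ d. The Lebesgue area of the set {p ∈ ℝ² : ‖p‖ ≤ d and p₂ ≤ √(d² − a²)} (the part of the closed disk of radius d centered at the origin lying on one side of a chord of half-length a, including the larger circular segment) equals d²·(π − arcsin(a/d)) + a·√(d² − a²). -/
open MeasureTheory Real

lemma ads_integral (d c : ℝ) (hd : 0 < d) (hc0 : -d ≤ c) (hcd : c ≤ d) :
    ∫ y in (-d)..c, 2 * Real.sqrt (d ^ 2 - y ^ 2)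
      = c * Real.sqrt (d ^ 2 - c ^ 2) + d ^ 2 * Real.arcsin (c / d) + d ^ 2 * (π / 2) := by
  have hcont : Continuous (fun y : ℝ => 2 * Real.sqrt (d ^ 2 - y ^ 2)) := by fun_prop
  have key := intervalIntegral.integral_eq_sub_of_hasDerivAt_of_le (a := -d) (b := c)
    (f := fun y => y * Real.sqrt (d ^ 2 - y ^ 2) + d ^ 2 * Real.arcsin (y / d))
    (f' := fun y : ℝ => 2 * Real.sqrt (d ^ 2 - y ^ 2)) hc0
    (by
      apply Continuous.continuousOn
      have : Continuous (fun y : ℝ => Real.arcsin (y / d)) :=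
        Real.continuous_arcsin.comp (by fun_prop)
      fun_prop)
    (by
      intro y hy
      obtain ⟨h1, h2⟩ := hy
      have hyd : y < d := lt_of_lt_of_le h2 hcd
      have hpos : 0 < d ^ 2 - y ^ 2 := by nlinarith
      have hs : 0 < Real.sqrt (d ^ 2 - y ^ 2) := Real.sqrt_pos.2 hpos
      have hsq : Real.sqrt (d ^ 2 - y ^ 2) ^ 2 = d ^ 2 - y ^ 2 := Real.sq_sqrt hpos.le
      have e : Real.sqrt (1 - (y / d) ^ 2) = Real.sqrt (d ^ 2 - y ^ 2) / d := by
        rw [show 1 - (y / d) ^ 2 = (d ^ 2 - y ^ 2) / d ^ 2 by field_simp,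
          Real.sqrt_div hpos.le, Real.sqrt_sq hd.le]
      have d1 : HasDerivAt (fun y : ℝ => d ^ 2 - y ^ 2) (-(2 * y)) y := by
        simpa using ((hasDerivAt_id y).pow 2).const_sub (d ^ 2)
      have d2 := d1.sqrt hpos.ne'
      have d3 := (hasDerivAt_id y).mul d2
      have d4 := (Real.hasDerivAt_arcsin (x := y / d)
        (by rw [Ne, div_eq_iff hd.ne']; linarith)
        (by rw [Ne, div_eq_iff hd.ne']; linarith)).comp y ((hasDerivAt_id y).div_const d)
      have d5 := d3.add (d4.const_mul (d ^ 2))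
      refine d5.congr_deriv ?_
      rw [e]
      simp only [id]
      field_simp
      rw [hsq]; ring)
    (hcont.intervalIntegrable _ _)
  rw [key]
  have : -d / d = -1 := by field_simp
  simp only [this, Real.arcsin_neg_one]
  simp
  

theorem ads_prod (d c : ℝ) (hd : 0 < d) (hc0 : -d ≤ c) (hcd : c ≤ d) :
    volume {q : ℝ × ℝ | q.1 ^ 2 + q.2 ^ 2 ≤ d ^ 2 ∧ q.2 ≤ c}
      = ENNReal.ofReal (∫ y in (-d)..c, 2 * Real.sqrt (d ^ 2 - y ^ 2)) := by
  have hm : MeasurableSet {q : ℝ × ℝ | q.1 ^ 2 + q.2 ^ 2 ≤ d ^ 2 ∧ q.2 ≤ c} := by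
    have h1 : IsClosed {q : ℝ × ℝ | q.1 ^ 2 + q.2 ^ 2 ≤ d ^ 2} :=
      isClosed_le (by fun_prop) (by fun_prop)
    have h2 : IsClosed {q : ℝ × ℝ | q.2 ≤ c} := isClosed_le (by fun_prop) (by fun_prop)
    exact (h1.inter h2).measurableSet
  have hcont : Continuous (fun y : ℝ => 2 * Real.sqrt (d ^ 2 - y ^ 2)) := by fun_prop
  rw [Measure.volume_eq_prod, Measure.prod_apply_symm hm,
    intervalIntegral.integral_of_le hc0, ← integral_Icc_eq_integral_Ioc,
    ofReal_integral_eq_lintegral_ofReal (hcont.integrableOn_Icc)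
      (Filter.Eventually.of_forall fun y => by positivity),
    ← lintegral_indicator measurableSet_Icc]
  congr 1
  ext y
  by_cases hy : y ∈ Set.Icc (-d) c
  · rw [Set.indicator_of_mem hy]
    have hn : 0 ≤ d ^ 2 - y ^ 2 := by nlinarith [hy.1, hy.2]
    have : (fun x : ℝ => (x, y)) ⁻¹' {q : ℝ × ℝ | q.1 ^ 2 + q.2 ^ 2 ≤ d ^ 2 ∧ q.2 ≤ c}
        = Set.Icc (-Real.sqrt (d ^ 2 - y ^ 2)) (Real.sqrt (d ^ 2 - y ^ 2)) := by
      ext x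
      simp only [Set.mem_preimage, Set.mem_ofPred_eq, Set.mem_Icc]
      rw [← abs_le, Real.le_sqrt (abs_nonneg x) hn, sq_abs]
      constructor
      · rintro ⟨h, _⟩; linarith
      · intro h; exact ⟨by linarith, hy.2⟩
    rw [this, Real.volume_Icc]
    congr 1; ring
  · rw [Set.indicator_of_notMem hy]
    have : (fun x : ℝ => (x, y)) ⁻¹' {q : ℝ × ℝ | q.1 ^ 2 + q.2 ^ 2 ≤ d ^ 2 ∧ q.2 ≤ c} = ∅ := by
      ext x
      simp only [Set.mem_preimage, Set.mem_ofPred_eq, Set.mem_empty_iff_false, iff_false]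
      rintro ⟨h1, h2⟩
      have := abs_le_of_sq_le_sq' (a := y) (b := d) (by nlinarith [sq_nonneg x]) hd.le
      exact hy ⟨this.1, h2⟩
    rw [this, measure_empty]

/-- **Area of a disk segment.** For `0 < d` and `0 ≤ a ≤ d`, the Lebesgue area of the part of
the closed disk of radius `d` centered at the origin lying on the side
`p₂ ≤ √(d² − a²)` of a chord of half-length `a` (the side containing the center) equals
`d²·(π − arcsin(a/d)) + a·√(d² − a²)`. -/
theorem area_disk_segment (d a : ℝ) (hd : 0 < d) (ha0 : 0 ≤ a) (had : a ≤ d) :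
    (volume {p : EuclideanSpace ℝ (Fin 2) |
        ‖p‖ ≤ d ∧ p 1 ≤ Real.sqrt (d ^ 2 - a ^ 2)}).toReal
      = d ^ 2 * (π - Real.arcsin (a / d)) + a * Real.sqrt (d ^ 2 - a ^ 2) := by
  have hn : 0 ≤ d ^ 2 - a ^ 2 := by nlinarith
  set c := Real.sqrt (d ^ 2 - a ^ 2) with hc
  have hc0 : 0 ≤ c := Real.sqrt_nonneg _
  have hcsq : c ^ 2 = d ^ 2 - a ^ 2 := Real.sq_sqrt hn
  have hcd : c ≤ d := by nlinarith
  have hmp := (volume_preserving_finTwoArrow ℝ).comp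
    (EuclideanSpace.volume_preserving_symm_measurableEquiv_toLp (Fin 2))
  have hm : MeasurableSet {q : ℝ × ℝ | q.1 ^ 2 + q.2 ^ 2 ≤ d ^ 2 ∧ q.2 ≤ c} := by
    have h1 : IsClosed {q : ℝ × ℝ | q.1 ^ 2 + q.2 ^ 2 ≤ d ^ 2} :=
      isClosed_le (by fun_prop) (by fun_prop)
    have h2 : IsClosed {q : ℝ × ℝ | q.2 ≤ c} := isClosed_le (by fun_prop) (by fun_prop)
    exact (h1.inter h2).measurableSet
  have h := hmp.measure_preimage hm.nullMeasurableSet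
  have hset : {p : EuclideanSpace ℝ (Fin 2) | ‖p‖ ≤ d ∧ p 1 ≤ c}
      = (⇑(MeasurableEquiv.finTwoArrow (α := ℝ)) ∘ ⇑(MeasurableEquiv.toLp 2 (Fin 2 → ℝ)).symm) ⁻¹'
        {q : ℝ × ℝ | q.1 ^ 2 + q.2 ^ 2 ≤ d ^ 2 ∧ q.2 ≤ c} := by
    ext p
    have : ‖p‖ ≤ d ↔ p 0 ^ 2 + p 1 ^ 2 ≤ d ^ 2 := by
      rw [EuclideanSpace.norm_eq, Real.sqrt_le_left hd.le]
      simp [Fin.sum_univ_two]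
    rw [Set.mem_ofPred_eq, this]
    rfl
  have hI := ads_integral d c hd (by linarith) hcd
  rw [hset, h, ads_prod d c hd (by linarith) hcd, ENNReal.toReal_ofReal, hI]
  · have e1 : d ^ 2 - c ^ 2 = a ^ 2 := by rw [hcsq]; ring
    have e2 : Real.arcsin (c / d) = π / 2 - Real.arcsin (a / d) := by
      rw [← Real.arccos_eq_pi_div_two_sub_arcsin, Real.arccos_eq_arcsin (by positivity),
        show 1 - (a / d) ^ 2 = (d ^ 2 - a ^ 2) / d ^ 2 by field_simp,
        Real.sqrt_div hn, Real.sqrt_sq hd.le]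
    rw [e1, Real.sqrt_sq ha0, e2]; ring
  · exact intervalIntegral.integral_nonneg (by linarith) fun y _ => by positivity
end

section
/- Let x, y, z ∈ ℝ² be affinely independent, set a = |x − y|/2, and let R denote the circumradius of the triangle with vertices x, y, z (the radius of the unique circle passing through x, y, z). Let 0 ≤ d₋ ≤ d₊. If the undirected angle ∠xzy at the vertex z is at most π/2 and max(d₋, a) < R ≤ d₊, then z ∈ D_{d₋,d₊}(x,y). -/
open MeasureTheory Real
open scoped Classical

lemma normsq_E2 (v : E2) : ‖v‖ ^ 2 = v 0 ^ 2 + v 1 ^ 2 := by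
  rw [EuclideanSpace.norm_sq_eq]; simp [Fin.sum_univ_two]

lemma mem_disk_iff (x y z : E2) (hxy : x ≠ y) (d s : ℝ) (hs : s ^ 2 = 1)
    (hd0 : 0 ≤ d) (hd : ‖y - x‖ / 2 ≤ d) :
    z ∈ diskPM x y d s ↔
      ((x 0 - z 0) * (y 0 - z 0) + (x 1 - z 1) * (y 1 - z 1)) * ‖y - x‖ ≤
        2 * s * Real.sqrt (d ^ 2 - (‖y - x‖ / 2) ^ 2) *
          (-(z 0 - (x 0 + y 0) / 2) * (y 1 - x 1) + (z 1 - (x 1 + y 1) / 2) * (y 0 - x 0)) := by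
  have hL : 0 < ‖y - x‖ := norm_pos_iff.2 (sub_ne_zero.2 hxy.symm)
  have hL2 := normsq_E2 (y - x)
  simp only [PiLp.sub_apply] at hL2
  rw [diskPM, if_neg (not_lt.2 hd), Metric.mem_closedBall, dist_eq_norm,
    ← sq_le_sq₀ (norm_nonneg _) hd0, normsq_E2]
  have hr : Real.sqrt (d ^ 2 - (‖y - x‖ / 2) ^ 2) ^ 2 = d ^ 2 - (‖y - x‖ / 2) ^ 2 := by
    apply Real.sq_sqrt
    nlinarith
  have h0 : (midpoint ℝ x y) 0 = (x 0 + y 0) / 2 := by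
    rw [midpoint_eq_smul_add]; simp; ring
  have h1 : (midpoint ℝ x y) 1 = (x 1 + y 1) / 2 := by
    rw [midpoint_eq_smul_add]; simp; ring
  simp only [PiLp.sub_apply, PiLp.add_apply, PiLp.smul_apply, perp, h0, h1, smul_eq_mul,
    WithLp.equiv_symm_apply, Matrix.cons_val_zero, Matrix.cons_val_one]
  generalize Real.sqrt (d ^ 2 - (‖y - x‖ / 2) ^ 2) = r at *
  generalize ‖y - x‖ = L at *
  obtain ⟨k, hk⟩ : ∃ k, k = s * r / L := ⟨_, rfl⟩
  have hkL : s * r = k * L := by rw [hk]; field_simp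
  rw [← hk]
  have hk2 : k ^ 2 * L ^ 2 = d ^ 2 - (L / 2) ^ 2 := by
    rw [← hr, ← mul_pow, ← hkL, mul_pow, hs, one_mul]
  rw [mul_assoc 2 s r, hkL, show ∀ A : ℝ, 2 * (k * L) * A = (2 * k * A) * L by intro A; ring,
    mul_le_mul_iff_left₀ hL]
  rw [hL2] at hk2
  constructor <;> intro h <;> nlinarith


/-- **Killing configuration lies in `D_{d₋,d₊}`.** Let `x, y, z` be affinely independent
points of the plane, `a = |x − y|/2`, and let `R` be the circumradius of the triangle
`xyz` (the radius of the unique circle through `x, y, z`, characterized by the existence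
of a point equidistant from all three). If `0 ≤ d₋ ≤ d₊`, the undirected angle `∠xzy`
is at most `π/2` and `max(d₋, a) < R ≤ d₊`, then `z ∈ D_{d₋,d₊}(x,y)`. -/
theorem mem_Dset_of_circumradius (x y z : E2)
    (hind : AffineIndependent ℝ ![x, y, z])
    (a R : ℝ) (ha : a = ‖x - y‖ / 2)
    (hR : ∃ o : E2, dist o x = R ∧ dist o y = R ∧ dist o z = R)
    (dm dp : ℝ) (hdm : 0 ≤ dm) (hdmdp : dm ≤ dp)
    (hangle : EuclideanGeometry.angle x z y ≤ π / 2)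
    (hR1 : max dm a < R) (hR2 : R ≤ dp) :
    z ∈ Dset x y dm dp := by
  have hxy : x ≠ y := fun h => by
    have := hind.injective.ne (show (0 : Fin 3) ≠ 1 by decide); simp at this; exact this h
  have hxz : x ≠ z := fun h => by
    have := hind.injective.ne (show (0 : Fin 3) ≠ 2 by decide); simp at this; exact this h
  have hyz : y ≠ z := fun h => by
    have := hind.injective.ne (show (1 : Fin 3) ≠ 2 by decide); simp at this; exact this h
  rw [norm_sub_rev] at ha
  have hL : 0 < ‖y - x‖ := norm_pos_iff.2 (sub_ne_zero.2 hxy.symm)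
  have hL2 := normsq_E2 (y - x)
  have hxz2 : 0 < ‖x - z‖ ^ 2 := by have := norm_pos_iff.2 (sub_ne_zero.2 hxz); positivity
  have hyz2 : 0 < ‖y - z‖ ^ 2 := by have := norm_pos_iff.2 (sub_ne_zero.2 hyz); positivity
  rw [normsq_E2] at hxz2 hyz2
  obtain ⟨o, hox, hoy, hoz⟩ := hR
  have hin : 0 ≤ (x 0 - z 0) * (y 0 - z 0) + (x 1 - z 1) * (y 1 - z 1) := by
    have h := InnerProductGeometry.cos_angle_mul_norm_mul_norm (x - z) (y - z)
    have hc : 0 ≤ Real.cos (InnerProductGeometry.angle (x - z) (y - z)) :=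
      Real.cos_nonneg_of_neg_pi_div_two_le_of_le
        (by linarith [InnerProductGeometry.angle_nonneg (x - z) (y - z), Real.pi_pos])
        (by simpa [EuclideanGeometry.angle] using hangle)
    have h3 : 0 ≤ inner ℝ (x - z) (y - z) := by rw [← h]; positivity
    simp [PiLp.inner_apply, Fin.sum_univ_two] at h3
    linarith
  have hmR : max dm (‖y - x‖ / 2) < R := by rw [← ha]; exact hR1
  have hdR : ‖y - x‖ / 2 < R := lt_of_le_of_lt (le_max_right _ _) hmR
  have hR0 : 0 < R := by linarith
  have hm0 : 0 ≤ max dm (‖y - x‖ / 2) := le_trans hdm (le_max_left _ _)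
  have hml : ‖y - x‖ / 2 ≤ max dm (‖y - x‖ / 2) := le_max_right _ _
  have e1 : (o 0 - x 0) ^ 2 + (o 1 - x 1) ^ 2 = R ^ 2 := by
    rw [← hox, dist_eq_norm, normsq_E2]; simp
  have e2 : (o 0 - y 0) ^ 2 + (o 1 - y 1) ^ 2 = R ^ 2 := by
    rw [← hoy, dist_eq_norm, normsq_E2]; simp
  have e3 : (o 0 - z 0) ^ 2 + (o 1 - z 1) ^ 2 = R ^ 2 := by
    rw [← hoz, dist_eq_norm, normsq_E2]; simp
  rw [Dset, if_neg hxy]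
  simp only [Set.mem_sdiff, Set.mem_union]
  rw [mem_disk_iff x y z hxy dp 1 (by norm_num) (by linarith) (by linarith),
    mem_disk_iff x y z hxy dp (-1) (by norm_num) (by linarith) (by linarith),
    mem_disk_iff x y z hxy _ 1 (by norm_num) hm0 hml,
    mem_disk_iff x y z hxy _ (-1) (by norm_num) hm0 hml]
  generalize max dm (‖y - x‖ / 2) = M at *
  have hs1 : Real.sqrt (R ^ 2 - (‖y - x‖ / 2) ^ 2) ≤ Real.sqrt (dp ^ 2 - (‖y - x‖ / 2) ^ 2) := by
    apply Real.sqrt_le_sqrt; linarith [pow_le_pow_left₀ hR0.le hR2 2]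
  have hs2 : Real.sqrt (M ^ 2 - (‖y - x‖ / 2) ^ 2) < Real.sqrt (R ^ 2 - (‖y - x‖ / 2) ^ 2) := by
    have h1 := pow_le_pow_left₀ (by positivity) hml 2
    have h2 := pow_lt_pow_left₀ hmR hm0 two_ne_zero
    apply Real.sqrt_lt_sqrt <;> linarith
  have hs0 : 0 ≤ Real.sqrt (M ^ 2 - (‖y - x‖ / 2) ^ 2) := Real.sqrt_nonneg _
  have hsq : Real.sqrt (R ^ 2 - (‖y - x‖ / 2) ^ 2) ^ 2 = R ^ 2 - (‖y - x‖ / 2) ^ 2 := by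
    apply Real.sq_sqrt; linarith [pow_le_pow_left₀ (by positivity) hdR.le 2]
  generalize Real.sqrt (R ^ 2 - (‖y - x‖ / 2) ^ 2) = r at *
  generalize Real.sqrt (M ^ 2 - (‖y - x‖ / 2) ^ 2) = rm at *
  generalize Real.sqrt (dp ^ 2 - (‖y - x‖ / 2) ^ 2) = rp at *
  generalize ‖y - x‖ = L at *
  simp only [PiLp.sub_apply] at hL2 hxz2 hyz2
  generalize x 0 = x0 at *
  generalize x 1 = x1 at *
  generalize y 0 = y0 at *
  generalize y 1 = y1 at *
  generalize z 0 = z0 at *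
  generalize z 1 = z1 at *
  generalize o 0 = o0 at *
  generalize o 1 = o1 at *
  obtain ⟨Q, hQ⟩ : ∃ Q, Q = (x0 - z0) * (y0 - z0) + (x1 - z1) * (y1 - z1) := ⟨_, rfl⟩
  obtain ⟨S, hS⟩ : ∃ S, S = -(z0 - (x0 + y0) / 2) * (y1 - x1) + (z1 - (x1 + y1) / 2) * (y0 - x0) :=
    ⟨_, rfl⟩
  obtain ⟨T, hT⟩ : ∃ T, T = -(o0 - (x0 + y0) / 2) * (y1 - x1) + (o1 - (x1 + y1) / 2) * (y0 - x0) :=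
    ⟨_, rfl⟩
  rw [← hQ, ← hS]
  rw [← hQ] at hin
  have hN : (o0 - (x0 + y0) / 2) * (y0 - x0) + (o1 - (x1 + y1) / 2) * (y1 - x1) = 0 := by
    linarith
  have hT2 : T ^ 2 = L ^ 2 * r ^ 2 := by
    have h1 : T ^ 2 + ((o0 - (x0 + y0) / 2) * (y0 - x0) + (o1 - (x1 + y1) / 2) * (y1 - x1)) ^ 2
      = ((o0 - (x0 + y0) / 2) ^ 2 + (o1 - (x1 + y1) / 2) ^ 2) * L ^ 2 := by
      rw [hT, hL2]; ring
    have h2 : (o0 - (x0 + y0) / 2) ^ 2 + (o1 - (x1 + y1) / 2) ^ 2 = r ^ 2 := by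
      rw [hsq, div_pow, hL2]; linarith
    rw [hN, h2] at h1; linarith
  have hQT : Q * L ^ 2 = 2 * S * T := by
    have h1 : S * T + ((z0 - (x0 + y0) / 2) * (y0 - x0) + (z1 - (x1 + y1) / 2) * (y1 - x1)) *
        ((o0 - (x0 + y0) / 2) * (y0 - x0) + (o1 - (x1 + y1) / 2) * (y1 - x1))
      = ((z0 - (x0 + y0) / 2) * (o0 - (x0 + y0) / 2) +
          (z1 - (x1 + y1) / 2) * (o1 - (x1 + y1) / 2)) * L ^ 2 := by
      rw [hT, hS, hL2]; ring
    have h2 : Q = 2 * ((z0 - (x0 + y0) / 2) * (o0 - (x0 + y0) / 2) +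
          (z1 - (x1 + y1) / 2) * (o1 - (x1 + y1) / 2)) := by
      rw [hQ]; linarith
    rw [hN] at h1; rw [h2]; linarith
  have hS0 : S ≠ 0 := by
    intro h
    have hQ0 : Q = 0 := by
      rw [h] at hQT
      have : L ^ 2 ≠ 0 := by positivity
      simpa [this] using hQT
    have h1 : ((x0 - z0) ^ 2 + (x1 - z1) ^ 2) * ((y0 - z0) ^ 2 + (y1 - z1) ^ 2)
      = Q ^ 2 + S ^ 2 := by rw [hQ, hS]; ring
    have := mul_pos hxz2 hyz2
    rw [h1, h, hQ0] at this
    norm_num at this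
  have hr0 : 0 < r := by linarith
  have key : Q * L = 2 * r * |S| := by
    have hTa : |T| = L * r := by
      rw [← abs_of_pos (mul_pos hL hr0), ← sq_eq_sq_iff_abs_eq_abs, hT2]; ring
    have h1 : |Q * L ^ 2| = 2 * |S| * (L * r) := by
      rw [hQT, abs_mul, abs_mul, hTa]; norm_num
    rw [abs_of_nonneg (by positivity)] at h1
    apply mul_right_cancel₀ hL.ne'
    linarith
  have hSp := abs_pos.2 hS0
  rw [key]
  refine ⟨?_, ?_⟩
  · rcases le_total 0 S with h | h
    · left; rw [abs_of_nonneg h]; linarith [mul_le_mul_of_nonneg_right hs1 h]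
    · right; rw [abs_of_nonpos h]; linarith [mul_le_mul_of_nonpos_right hs1 h]
  · have h1 := mul_lt_mul_of_pos_right hs2 hSp
    have h2 := mul_le_mul_of_nonneg_left (le_abs_self S) hs0
    have h3 := mul_le_mul_of_nonneg_left (neg_le_abs S) hs0
    rintro (h | h) <;> linarith
end

section
/- Let x, y ∈ ℝ² with x ≠ y, set a = |x − y|/2, let d ≥ a, and let z ∈ ℝ² not lie on the affine line through x and y. Then z ∈ B_d^+(x,y) ∪ B_d^-(x,y) if and only if the undirected angle ∠xzy at the vertex z satisfies ∠xzy ≥ arcsin(a/d). -/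
open MeasureTheory Real
open scoped Classical

theorem aux_alg (a d h I C N : ℝ) (ha : 0 < a) (hd : 0 < d) (hh : 0 ≤ h) (hN : 0 < N)
    (h2 : h ^ 2 = d ^ 2 - a ^ 2) (hN2 : N ^ 2 = I ^ 2 + C ^ 2) :
    (a * I + h * C ≤ 0 ∨ a * I - h * C ≤ 0) ↔ I * d ≤ h * N := by
  have e1 : (a * I + h * C ≤ 0 ∨ a * I - h * C ≤ 0) ↔ a * I ≤ h * |C| := by
    rcases le_total 0 C with hC | hC
    · rw [abs_of_nonneg hC]
      have := mul_nonneg hh hC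
      constructor
      · rintro (h | h) <;> linarith
      · intro h; right; linarith
    · rw [abs_of_nonpos hC]
      have := mul_nonneg hh (neg_nonneg.2 hC)
      constructor
      · rintro (h | h) <;> linarith
      · intro h; left; linarith
  rw [e1]
  rcases le_total I 0 with hI | hI
  · have p1 : 0 ≤ h * |C| := by positivity
    have p2 : 0 ≤ h * N := by positivity
    have p3 := mul_nonneg ha.le (neg_nonneg.2 hI)
    have p4 := mul_nonneg hd.le (neg_nonneg.2 hI)
    constructor <;> intro _ <;> linarith
  · rw [← sq_le_sq₀ (by positivity) (by positivity), ← sq_le_sq₀ (a := I * d) (by positivity) (by positivity)]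
    have e : (h * |C|) ^ 2 - (a * I) ^ 2 = (h * N) ^ 2 - (I * d) ^ 2 := by
      rw [mul_pow, mul_pow, mul_pow, mul_pow, sq_abs, hN2, h2]; ring
    constructor <;> intro _ <;> linarith

theorem aux_disk_s9 (x y z : E2) (a d h s : ℝ) (ha : 0 < a) (hd : 0 < d)
    (hn : ‖y - x‖ = 2 * a) (had : a ≤ d) (hh : h = √(d ^ 2 - a ^ 2)) (hs : s ^ 2 = 1) :
    z ∈ diskPM x y d s ↔
      a * ((x 0 - z 0) * (y 0 - z 0) + (x 1 - z 1) * (y 1 - z 1)) +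
        s * (h * ((x 1 - z 1) * (y 0 - z 0) - (x 0 - z 0) * (y 1 - z 1))) ≤ 0 := by
  have hx2 : (y 0 - x 0) ^ 2 + (y 1 - x 1) ^ 2 = 4 * a ^ 2 := by
    have := EuclideanSpace.real_norm_sq_eq (y - x)
    rw [hn] at this
    simp [Fin.sum_univ_two] at this
    linarith
  have h2 : h ^ 2 = d ^ 2 - a ^ 2 := by
    rw [hh, Real.sq_sqrt]; nlinarith
  unfold diskPM
  rw [hn, mul_div_cancel_left₀ _ (two_ne_zero), if_neg (not_lt.2 had), ← hh, Metric.mem_closedBall,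
    dist_eq_norm, ← sq_le_sq₀ (norm_nonneg _) hd.le, EuclideanSpace.real_norm_sq_eq]
  simp only [Fin.sum_univ_two, perp, midpoint_eq_smul_add]
  simp
  set k := s * h / (2 * a) with hk
  have hk1 : s * h = 2 * a * k := by rw [hk]; field_simp
  have hk2 : 4 * a ^ 2 * k ^ 2 = d ^ 2 - a ^ 2 := by
    rw [← h2]
    calc _ = (2 * a * k) ^ 2 := by ring
      _ = s ^ 2 * h ^ 2 := by rw [← hk1]; ring
      _ = _ := by rw [hs]; ring
  rw [← mul_assoc, hk1]
  have key : ∀ L R I C: ℝ, L - R = I + 2 * k * C → (L ≤ R ↔ a * I + 2 * a * k * C ≤ 0) := by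
    intro L R I C e
    have : a * I + 2 * a * k * C = a * (L - R) := by rw [e]; ring
    rw [this, ← sub_nonpos]
    constructor
    · intro h; exact mul_nonpos_of_nonneg_of_nonpos ha.le h
    · intro h; by_contra hc; exact absurd (mul_pos ha (not_le.1 hc)) (not_lt.2 h)
  apply key
  linear_combination (k ^ 2 + 1 / 4) * hx2 + hk2

/-- **Inscribed-angle description of `B_d^+ ∪ B_d^-`.** Let `x ≠ y` in the plane,
`a = |x − y|/2 ≤ d`, and let `z` not lie on the affine line through `x` and `y`.
Then `z ∈ B_d^+(x,y) ∪ B_d^-(x,y)` if and only if the undirected angle `∠xzy`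
satisfies `∠xzy ≥ arcsin(a/d)`. -/
theorem mem_union_diskPM_iff_angle (x y : E2) (hxy : x ≠ y) (a d : ℝ)
    (ha : a = ‖x - y‖ / 2) (had : a ≤ d)
    (z : E2) (hz : z ∉ affineSpan ℝ ({x, y} : Set E2)) :
    z ∈ diskPM x y d 1 ∪ diskPM x y d (-1) ↔
      Real.arcsin (a / d) ≤ EuclideanGeometry.angle x z y := by
  have hn : ‖y - x‖ = 2 * a := by rw [ha, norm_sub_rev]; ring
  have hapos : 0 < a := by
    rw [ha]; have := norm_pos_iff.2 (sub_ne_zero.2 hxy); positivity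
  have hd : 0 < d := hapos.trans_le had
  have hzx : x - z ≠ 0 := by
    intro h; apply hz; rw [← sub_eq_zero.1 h]; exact left_mem_affineSpan_pair ℝ x y
  have hzy : y - z ≠ 0 := by
    intro h; apply hz; rw [← sub_eq_zero.1 h]; exact right_mem_affineSpan_pair ℝ x y
  have h2 : (√(d ^ 2 - a ^ 2)) ^ 2 = d ^ 2 - a ^ 2 := by
    rw [Real.sq_sqrt]; nlinarith
  have hN : 0 < ‖x - z‖ * ‖y - z‖ := mul_pos (norm_pos_iff.2 hzx) (norm_pos_iff.2 hzy)
  have hI : inner ℝ (x - z) (y - z) =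
      (x 0 - z 0) * (y 0 - z 0) + (x 1 - z 1) * (y 1 - z 1) := by
    simp [PiLp.inner_apply, Fin.sum_univ_two]; ring
  have hN2 : (‖x - z‖ * ‖y - z‖) ^ 2 =
      ((x 0 - z 0) * (y 0 - z 0) + (x 1 - z 1) * (y 1 - z 1)) ^ 2 +
      ((x 1 - z 1) * (y 0 - z 0) - (x 0 - z 0) * (y 1 - z 1)) ^ 2 := by
    rw [mul_pow, EuclideanSpace.real_norm_sq_eq, EuclideanSpace.real_norm_sq_eq]
    simp [Fin.sum_univ_two]; ring
  have hang : Real.arcsin (a / d) ≤ EuclideanGeometry.angle x z y ↔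
      ((x 0 - z 0) * (y 0 - z 0) + (x 1 - z 1) * (y 1 - z 1)) * d ≤
        √(d ^ 2 - a ^ 2) * (‖x - z‖ * ‖y - z‖) := by
    have m1 : Real.arcsin (a / d) ∈ Set.Icc 0 π :=
      ⟨Real.arcsin_nonneg.2 (by positivity), by
        linarith [Real.arcsin_le_pi_div_two (a / d), Real.pi_pos]⟩
    have m2 : EuclideanGeometry.angle x z y ∈ Set.Icc 0 π :=
      ⟨EuclideanGeometry.angle_nonneg _ _ _, EuclideanGeometry.angle_le_pi _ _ _⟩
    rw [← Real.strictAntiOn_cos.le_iff_ge m2 m1, Real.cos_arcsin]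
    have e : 1 - (a / d) ^ 2 = (d ^ 2 - a ^ 2) / d ^ 2 := by field_simp
    rw [e, Real.sqrt_div' _ (by positivity), Real.sqrt_sq hd.le, EuclideanGeometry.angle,
      InnerProductGeometry.cos_angle, vsub_eq_sub, vsub_eq_sub, hI, div_le_div_iff₀ hN hd]
  rw [hang, ← aux_alg a d _ _ _ _ hapos hd (Real.sqrt_nonneg _) hN h2 hN2, Set.mem_union,
    aux_disk_s9 x y z a d _ 1 hapos hd hn had rfl (by norm_num),
    aux_disk_s9 x y z a d _ (-1) hapos hd hn had rfl (by norm_num), one_mul, neg_one_mul,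
    ← sub_eq_add_neg]
end

section
/- For every r_f > 0 there exists a constant C > 0 such that the following holds. Let 0 ≤ b₋ < b₊ ≤ r_f and 0 ≤ b₋' < b₊' ≤ r_f, and let x, y ∈ ℝ² with a = |x − y|/2 satisfying 0 < a ≤ min(b₋, b₋') and a² ≥ 2·|b₁² − b₂²| for every pair b₁, b₂ ∈ {b₋, b₊, b₋', b₊'}. Then the Lebesgue area of A_{2b₋,2b₊}(x) ∩ A_{2b₋',2b₊'}(y) is at most C·(b₊ − b₋)·(b₊' − b₋')/a². -/
open MeasureTheory

/-- length of a set of reals bounded away from zero whose squares lie in an interval -/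
lemma aux_section (S : Set ℝ) (a A L : ℝ) (ha : 0 < a) (hL : 0 ≤ L)
    (hS : ∀ v ∈ S, a ^ 2 ≤ v ^ 2 ∧ A ≤ v ^ 2 ∧ v ^ 2 ≤ A + L) :
    volume S ≤ ENNReal.ofReal (L / a) := by
  have key : ∀ s : Set ℝ, (∀ v ∈ s, ∀ w ∈ s, |v - w| ≤ L / (2 * a)) →
      volume s ≤ ENNReal.ofReal (L / (2 * a)) := by
    intro s hs
    refine (Real.volume_le_diam s).trans ?_
    refine Metric.ediam_le fun v hv w hw => ?_
    rw [edist_dist, Real.dist_eq]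
    exact ENNReal.ofReal_le_ofReal (hs v hv w hw)
  have hsub : S ⊆ (S ∩ {v | 0 ≤ v}) ∪ (S ∩ {v | v ≤ 0}) := by
    intro v hv
    rcases le_total 0 v with h | h
    · exact Or.inl ⟨hv, h⟩
    · exact Or.inr ⟨hv, h⟩
  have h1 : volume (S ∩ {v | 0 ≤ v}) ≤ ENNReal.ofReal (L / (2 * a)) := by
    apply key
    rintro v ⟨hv, hv0⟩ w ⟨hw, hw0⟩
    obtain ⟨v1, v2, v3⟩ := hS v hv
    obtain ⟨w1, w2, w3⟩ := hS w hw
    simp only [Set.mem_ofPred_eq] at hv0 hw0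
    have v4 : a ≤ v := le_of_sq_le_sq v1 hv0
    have w4 : a ≤ w := le_of_sq_le_sq w1 hw0
    rw [le_div_iff₀ (by positivity)]
    rcases abs_cases (v - w) with ⟨h, _⟩ | ⟨h, _⟩ <;> rw [h] <;> nlinarith
  have h2 : volume (S ∩ {v | v ≤ 0}) ≤ ENNReal.ofReal (L / (2 * a)) := by
    apply key
    rintro v ⟨hv, hv0⟩ w ⟨hw, hw0⟩
    obtain ⟨v1, v2, v3⟩ := hS v hv
    obtain ⟨w1, w2, w3⟩ := hS w hw
    simp only [Set.mem_ofPred_eq] at hv0 hw0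
    have v4 : a ≤ -v := le_of_sq_le_sq (by linarith [neg_sq v]) (by linarith)
    have w4 : a ≤ -w := le_of_sq_le_sq (by linarith [neg_sq w]) (by linarith)
    rw [le_div_iff₀ (by positivity)]
    rcases abs_cases (v - w) with ⟨h, _⟩ | ⟨h, _⟩ <;> rw [h] <;> nlinarith
  calc volume S ≤ _ := measure_mono hsub
    _ ≤ _ := measure_union_le _ _
    _ ≤ _ := add_le_add h1 h2
    _ = _ := by
      rw [← ENNReal.ofReal_add (by positivity) (by positivity)]
      congr 1; field_simp; ring

lemma aux_plane (a A B A' B' : ℝ) (ha : 0 < a) (hAB : A ≤ B) (hAB' : A' ≤ B')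
    (hA : 4 * a ^ 2 ≤ A) (h1 : B - A' ≤ 2 * a ^ 2) (h2 : B' - A ≤ 2 * a ^ 2)
    (T : Set (ℝ × ℝ)) (hT : T = {z | (A < z.1 ^ 2 + z.2 ^ 2 ∧ z.1 ^ 2 + z.2 ^ 2 ≤ B) ∧
      (A' < (z.1 - 2 * a) ^ 2 + z.2 ^ 2 ∧ (z.1 - 2 * a) ^ 2 + z.2 ^ 2 ≤ B')}) :
    MeasurableSet T ∧ volume T ≤ ENNReal.ofReal ((B - A) * (B' - A') / (2 * a ^ 2)) := by
  have hm : MeasurableSet T := by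
    rw [hT]
    have c1 : Measurable fun z : ℝ × ℝ => z.1 ^ 2 + z.2 ^ 2 := by fun_prop
    have c2 : Measurable fun z : ℝ × ℝ => (z.1 - 2 * a) ^ 2 + z.2 ^ 2 := by fun_prop
    exact ((measurableSet_lt measurable_const c1).inter
      (measurableSet_le c1 measurable_const)).inter
      ((measurableSet_lt measurable_const c2).inter (measurableSet_le c2 measurable_const))
  refine ⟨hm, ?_⟩
  set M := min (B - A) (B' - A') with hM
  have hM0 : 0 ≤ M := le_min (by linarith) (by linarith)
  set U : Set ℝ := Set.Icc (a + (A - B') / (4 * a)) (a + (B - A') / (4 * a)) with hU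
  have hmem : ∀ u v : ℝ, (u, v) ∈ T → u ∈ U ∧ a ^ 2 ≤ v ^ 2 := by
    intro u v h
    rw [hT] at h
    obtain ⟨⟨p1, p2⟩, q1, q2⟩ := h
    simp only at p1 p2 q1 q2
    refine ⟨⟨?_, ?_⟩, ?_⟩
    · rw [← le_sub_iff_add_le', div_le_iff₀ (by positivity)]; nlinarith
    · rw [← sub_le_iff_le_add', le_div_iff₀ (by positivity)]; nlinarith
    · have u1 : u ≤ 3 / 2 * a := by
        have : a * u ≤ a * (3 / 2 * a) := by nlinarith
        exact le_of_mul_le_mul_left this ha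
      have u2 : a / 2 ≤ u := by
        have : a * (a / 2) ≤ a * u := by nlinarith
        exact le_of_mul_le_mul_left this ha
      nlinarith
  have hsec : ∀ u : ℝ, volume (Prod.mk u ⁻¹' T) ≤
      U.indicator (fun _ => ENNReal.ofReal (M / a)) u := by
    intro u
    by_cases hu : u ∈ U
    · rw [Set.indicator_of_mem hu]
      rcases min_choice (B - A) (B' - A') with h | h
      · rw [hM, h]
        refine aux_section _ a (A - u ^ 2) _ ha (by linarith) fun v hv => ?_
        refine ⟨(hmem u v hv).2, ?_⟩
        have hv' : (u, v) ∈ T := hv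
        rw [hT] at hv'
        obtain ⟨⟨p1, p2⟩, q1, q2⟩ := hv'
        simp only at p1 p2 q1 q2
        constructor <;> linarith
      · rw [hM, h]
        refine aux_section _ a (A' - (u - 2 * a) ^ 2) _ ha (by linarith) fun v hv => ?_
        refine ⟨(hmem u v hv).2, ?_⟩
        have hv' : (u, v) ∈ T := hv
        rw [hT] at hv'
        obtain ⟨⟨p1, p2⟩, q1, q2⟩ := hv'
        simp only at p1 p2 q1 q2
        constructor <;> linarith
    · have : Prod.mk u ⁻¹' T = ∅ := by
        ext v
        simp only [Set.mem_preimage, Set.mem_empty_iff_false, iff_false]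
        exact fun h => hu (hmem u v h).1
      rw [this]; simp
  rw [Measure.volume_eq_prod, Measure.prod_apply hm]
  refine (lintegral_mono hsec).trans ?_
  rw [lintegral_indicator measurableSet_Icc, lintegral_const, Measure.restrict_apply_univ,
    Real.volume_Icc, ← ENNReal.ofReal_mul (by positivity)]
  apply ENNReal.ofReal_le_ofReal
  have e : M / a * (a + (B - A') / (4 * a) - (a + (A - B') / (4 * a)))
      = M * ((B - A) + (B' - A')) / 2 / (2 * a ^ 2) := by field_simp; ring
  rw [e]
  apply div_le_div_of_nonneg_right _ (by positivity)
  have m1 : M ≤ B - A := min_le_left _ _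
  have m2 : M ≤ B' - A' := min_le_right _ _
  have p := mul_le_mul_of_nonneg_right m1 (sub_nonneg.2 hAB')
  have q := mul_le_mul_of_nonneg_right m2 (sub_nonneg.2 hAB)
  linarith

lemma aux_coords (x y : EuclideanSpace ℝ (Fin 2)) (a : ℝ) (h : a = ‖x - y‖ / 2) (ha : 0 < a) :
    ∃ f : EuclideanSpace ℝ (Fin 2) → ℝ × ℝ, MeasurePreserving f volume volume ∧
      ∀ p, dist p x ^ 2 = (f p).1 ^ 2 + (f p).2 ^ 2 ∧
        dist p y ^ 2 = ((f p).1 - 2 * a) ^ 2 + (f p).2 ^ 2 := by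
  have hn : ‖y - x‖ = 2 * a := by rw [norm_sub_rev]; linarith
  obtain ⟨b, hb⟩ := Orthonormal.exists_orthonormalBasis_extension_of_card_eq (𝕜 := ℝ)
    (E := EuclideanSpace ℝ (Fin 2)) (ι := Fin 2) (by simp)
    (v := fun _ => (2 * a)⁻¹ • (y - x)) (s := {0}) (by
      constructor
      · intro i
        simp only [Set.domRestrict_apply, norm_smul, hn]
        rw [Real.norm_of_nonneg (by positivity)]
        field_simp
      · intro i j hij
        exact absurd (Subsingleton.elim i j) hij)
  have hb0 : b 0 = (2 * a)⁻¹ • (y - x) := hb 0 rfl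
  have hyx : b.repr (y - x) = EuclideanSpace.single 0 (2 * a) := by
    have : y - x = (2 * a) • b 0 := by
      rw [hb0, smul_smul, mul_inv_cancel₀ (by positivity), one_smul]
    rw [this, map_smul, b.repr_self]
    ext i
    simp
  refine ⟨fun p => (b.repr (p - x) 0, b.repr (p - x) 1), ?_, ?_⟩
  · have m1 : MeasurePreserving (fun p : EuclideanSpace ℝ (Fin 2) => p - x) volume volume :=
      measurePreserving_sub_right volume x
    have m2 := b.measurePreserving_repr
    have m3 := PiLp.volume_preserving_ofLp (Fin 2)
    have m4 := volume_preserving_finTwoArrow ℝ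
    exact m4.comp (m3.comp (m2.comp m1))
  · intro p
    constructor
    · rw [dist_eq_norm, ← b.repr.norm_map, EuclideanSpace.norm_sq_eq]
      simp
    · have : p - y = (p - x) - (y - x) := by abel
      rw [dist_eq_norm, ← b.repr.norm_map, this, map_sub, hyx, EuclideanSpace.norm_sq_eq]
      simp

/-- **Bound on the area of the intersection of two annuli (Lemma 7.7, Term II).**
For every `r_f > 0` there is `C > 0` such that for all `0 ≤ b₋ < b₊ ≤ r_f`,
`0 ≤ b₋' < b₊' ≤ r_f` and `x, y ∈ ℝ²` with `a = |x − y|/2` satisfying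
`0 < a ≤ min(b₋, b₋')` and `a² ≥ 2|b₁² − b₂²|` for all pairs `b₁, b₂ ∈ {b₋,b₊,b₋',b₊'}`,
the Lebesgue area of `A_{2b₋,2b₊}(x) ∩ A_{2b₋',2b₊'}(y)` is at most
`C·(b₊ − b₋)·(b₊' − b₋')/a²`. -/
theorem area_inter_annuli_le (rf : ℝ) (hrf : 0 < rf) :
    ∃ C > 0, ∀ (bm bp bm' bp' : ℝ),
      0 ≤ bm → bm < bp → bp ≤ rf → 0 ≤ bm' → bm' < bp' → bp' ≤ rf →
      ∀ (x y : EuclideanSpace ℝ (Fin 2)) (a : ℝ), a = ‖x - y‖ / 2 →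
      0 < a → a ≤ min bm bm' →
      (∀ b₁ ∈ ({bm, bp, bm', bp'} : Set ℝ), ∀ b₂ ∈ ({bm, bp, bm', bp'} : Set ℝ),
        2 * |b₁ ^ 2 - b₂ ^ 2| ≤ a ^ 2) →
      (volume ((Metric.closedBall x (2 * bp) \ Metric.closedBall x (2 * bm)) ∩
          (Metric.closedBall y (2 * bp') \ Metric.closedBall y (2 * bm')))).toReal
        ≤ C * (bp - bm) * (bp' - bm') / a ^ 2 := by
  refine ⟨32 * rf ^ 2, by positivity, ?_⟩
  intro bm bp bm' bp' h0 h1 h2 h0' h1' h2' x y a hxy ha hmin hall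
  obtain ⟨f, hf, hd⟩ := aux_coords x y a hxy ha
  have i1 := hall bp (by simp) bm' (by simp)
  have i2 := hall bp' (by simp) bm (by simp)
  have j1 := le_abs_self (bp ^ 2 - bm' ^ 2)
  have j2 := le_abs_self (bp' ^ 2 - bm ^ 2)
  have k : a ≤ bm := hmin.trans (min_le_left _ _)
  have kk : a ^ 2 ≤ bm ^ 2 := pow_le_pow_left₀ ha.le k 2
  have l1 : bm ^ 2 ≤ bp ^ 2 := pow_le_pow_left₀ h0 h1.le 2
  have l2 : bm' ^ 2 ≤ bp' ^ 2 := pow_le_pow_left₀ h0' h1'.le 2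
  obtain ⟨hm, hv⟩ := aux_plane a (4 * bm ^ 2) (4 * bp ^ 2) (4 * bm' ^ 2) (4 * bp' ^ 2) ha
    (by linarith) (by linarith) (by linarith) (by linarith) (by linarith) _ rfl
  rw [← hf.measure_preimage hm.nullMeasurableSet] at hv
  have hnn : 0 ≤ (4 * bp ^ 2 - 4 * bm ^ 2) * (4 * bp' ^ 2 - 4 * bm' ^ 2) / (2 * a ^ 2) :=
    div_nonneg (mul_nonneg (by linarith) (by linarith)) (by positivity)
  have hb1 : bp ^ 2 - bm ^ 2 ≤ 2 * rf * (bp - bm) := by nlinarith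
  have hb2 : bp' ^ 2 - bm' ^ 2 ≤ 2 * rf * (bp' - bm') := by nlinarith
  have hb3 := mul_le_mul hb1 hb2 (by linarith)
    (mul_nonneg (by positivity) (sub_nonneg.2 h1.le))
  calc _ ≤ (4 * bp ^ 2 - 4 * bm ^ 2) * (4 * bp' ^ 2 - 4 * bm' ^ 2) / (2 * a ^ 2) := by
        refine ENNReal.toReal_le_of_le_ofReal hnn (le_trans (measure_mono ?_) hv)
        rintro p ⟨⟨p1, p2⟩, q1, q2⟩
        rw [Metric.mem_closedBall] at p1 p2 q1 q2
        rw [not_le] at p2 q2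
        have s1 := pow_le_pow_left₀ dist_nonneg p1 2
        have s2 := pow_lt_pow_left₀ p2 (by positivity) two_ne_zero
        have s3 := pow_le_pow_left₀ dist_nonneg q1 2
        have s4 := pow_lt_pow_left₀ q2 (by positivity) two_ne_zero
        rw [(hd p).1] at s1 s2
        rw [(hd p).2] at s3 s4
        simp only [Set.mem_preimage, Set.mem_ofPred_eq]
        refine ⟨⟨?_, ?_⟩, ?_, ?_⟩ <;> linarith
    _ = 8 * ((bp ^ 2 - bm ^ 2) * (bp' ^ 2 - bm' ^ 2)) / a ^ 2 := by field_simp; ring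
    _ ≤ _ := by
        apply div_le_div_of_nonneg_right _ (by positivity)
        linarith
end
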